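/- arXiv:2110.02608 — 2 statements merged into one kernel-verified Lean document; each statement's English description precedes it below -/
import Mathlib

section
/- Assume the equation x' = −x² + p(t) has exactly two hyperbolic solutions. Then for every c > 0 exactly one of the following three mutually exclusive alternatives holds for the equation y' = −(y − (2/π)arctan(ct))² + p(t): (Case A) it has two different hyperbolic solutions; (Case B) it has exactly one globally defined bounded solution; (Case C) it has no globally defined bounded solution. -/
open Set Filter

/-- The right-hand side of the quadratic equation `x' = -x² + Q(t)x + P(t)`. -/
def quadF (Q P : ℝ → ℝ) : ℝ → ℝ → ℝ := fun t x => -x ^ 2 + Q t * x + P t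

/-- `b` is a globally defined bounded solution of `x' = -x² + Q(t)x + P(t)`. -/
def IsBddSol (Q P b : ℝ → ℝ) : Prop :=
  (∀ t, HasDerivAt b (quadF Q P t (b t)) t) ∧ ∃ C, ∀ t, |b t| ≤ C

/-- `(k, β)` is a dichotomy constant pair witnessing that the variational equation
`z' = (-2 b(t) + Q(t)) z` is Hurwitz at `+∞` (attractive case). -/
def AttrDich (Q b : ℝ → ℝ) (k β : ℝ) : Prop :=
  1 ≤ k ∧ 0 < β ∧ ∀ s t : ℝ, s ≤ t →
    Real.exp (∫ l in s..t, (-2 * b l + Q l)) ≤ k * Real.exp (-β * (t - s))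

/-- `(k, β)` is a dichotomy constant pair witnessing that the variational equation
`z' = (-2 b(t) + Q(t)) z` is Hurwitz at `−∞` (repulsive case). -/
def RepDich (Q b : ℝ → ℝ) (k β : ℝ) : Prop :=
  1 ≤ k ∧ 0 < β ∧ ∀ s t : ℝ, t ≤ s →
    Real.exp (∫ l in s..t, (-2 * b l + Q l)) ≤ k * Real.exp (β * (t - s))

/-- `b` is an attractive hyperbolic solution of `x' = -x² + Q(t)x + P(t)`. -/
def IsAttrHyp (Q P b : ℝ → ℝ) : Prop := IsBddSol Q P b ∧ ∃ k β : ℝ, AttrDich Q b k β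

/-- `b` is a repulsive hyperbolic solution of `x' = -x² + Q(t)x + P(t)`. -/
def IsRepHyp (Q P b : ℝ → ℝ) : Prop := IsBddSol Q P b ∧ ∃ k β : ℝ, RepDich Q b k β

/-- `b` is a hyperbolic solution of `x' = -x² + Q(t)x + P(t)`. -/
def IsHyp (Q P b : ℝ → ℝ) : Prop := IsAttrHyp Q P b ∨ IsRepHyp Q P b

/-- The supremum norm distance between `f` and `g` is `< δ`. -/
def SupLt (f g : ℝ → ℝ) (δ : ℝ) : Prop := ∃ d : ℝ, d < δ ∧ ∀ t, |f t - g t| ≤ d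

/-- `Q(t) = (4/π) arctan (c t)`: the equation `y' = −(y − (2/π)arctan(ct))² + p(t)`
written in the form `y' = −y² + Q(t)y + P(t)`. -/
noncomputable def Qarc (c : ℝ) : ℝ → ℝ := fun t => 4 / Real.pi * Real.arctan (c * t)

/-- `P(t) = p(t) − (4/π²) arctan²(c t)`. -/
noncomputable def Parc (p : ℝ → ℝ) (c : ℝ) : ℝ → ℝ :=
  fun t => p t - 4 / Real.pi ^ 2 * Real.arctan (c * t) ^ 2

/-- `x` is a globally defined bounded solution of the Riccati equation `x' = q(t) - x²`. -/
def IsBddRiccati (q x : ℝ → ℝ) : Prop :=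
  (∀ t, HasDerivAt x (q t - x t ^ 2) t) ∧ ∃ C, ∀ t, |x t| ≤ C

theorem exists_primitive {f : ℝ → ℝ} (hf : Continuous f) :
    ∃ A : ℝ → ℝ, (∀ t, HasDerivAt A (f t) t) ∧ ∀ s t, ∫ l in s..t, f l = A t - A s := by
  have h : ∀ t, HasDerivAt (fun t => ∫ l in (0 : ℝ)..t, f l) (f t) t := fun t =>
    intervalIntegral.integral_hasDerivAt_right (hf.intervalIntegrable _ _)
      (hf.stronglyMeasurableAtFilter _ _) hf.continuousAt
  exact ⟨_, h, fun s t => intervalIntegral.integral_eq_sub_of_hasDerivAt (fun x _ => h x)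
    (hf.intervalIntegrable _ _)⟩

theorem monotoneOn_Ici_of_hasDerivAt {f f' : ℝ → ℝ} {T : ℝ} (hf : ∀ t, HasDerivAt f (f' t) t)
    (h : ∀ t, T ≤ t → 0 ≤ f' t) : MonotoneOn f (Ici T) := by
  refine monotoneOn_of_deriv_nonneg (convex_Ici T)
    (fun t _ => (hf t).continuousAt.continuousWithinAt)
    (fun t _ => (hf t).differentiableAt.differentiableWithinAt) fun t ht => ?_
  rw [interior_Ici] at ht
  rw [(hf t).deriv]
  exact h t (le_of_lt ht)

/-- A perturbed logistic flow eventually stays either below `1/4` or above `3/4`. -/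
theorem logistic_eventually {d ε ρ : ℝ → ℝ} {m T : ℝ} (hm : 0 < m) (hd : ∀ t, m ≤ d t)
    (hε : ∀ t, T ≤ t → |ε t| ≤ m / 16)
    (hρ : ∀ t, HasDerivAt ρ (d t * ρ t * (1 - ρ t) - ε t) t) :
    (∀ t, T ≤ t → ρ t < 1 / 4) ∨ ∃ T', T ≤ T' ∧ ∀ t, T' ≤ t → 3 / 4 ≤ ρ t := by
  have hpos : ∀ t, T ≤ t → 1 / 4 ≤ ρ t → ρ t ≤ 3 / 4 →
      m / 8 ≤ d t * ρ t * (1 - ρ t) - ε t := fun t ht h1 h2 => by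
    have h3 := (abs_le.1 (hε t ht)).2
    have h4 : 3 / 16 ≤ ρ t * (1 - ρ t) := by nlinarith
    nlinarith [hd t]
  have hbar : ∀ v s, 1 / 4 ≤ v → v ≤ 3 / 4 → T ≤ s → v ≤ ρ s → ∀ t, s ≤ t → v ≤ ρ t := by
    intro v s hv1 hv2 hs hvs t hst
    refine image_le_of_deriv_right_lt_deriv_boundary' (f := fun _ => v) (f' := fun _ => 0)
      (B := ρ) (a := s) (b := t) continuousOn_const (fun r _ => hasDerivWithinAt_const _ _ _) hvs
      (fun r _ => (hρ r).continuousAt.continuousWithinAt) (fun r _ => (hρ r).hasDerivWithinAt)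
      (fun r hr hvr => ?_) ⟨hst, le_rfl⟩
    have := hpos r (hs.trans hr.1) (hvr ▸ hv1) (hvr ▸ hv2)
    linarith
  by_cases h : ∀ t, T ≤ t → ρ t < 1 / 4
  · exact Or.inl h
  push Not at h
  obtain ⟨s, hs, hρs⟩ := h
  refine Or.inr ?_
  by_cases h' : ∃ T', s ≤ T' ∧ 3 / 4 ≤ ρ T'
  · obtain ⟨T', hT', h'⟩ := h'
    exact ⟨T', hs.trans hT', hbar _ T' (by norm_num) le_rfl (hs.trans hT') h'⟩
  push Not at h'
  exfalso
  have hmono := monotoneOn_Ici_of_hasDerivAt (T := s)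
    (fun t => (hρ t).sub ((hasDerivAt_id t).const_mul (m / 8))) fun t hst => by
      have := hpos t (hs.trans hst) (hbar _ s le_rfl (by norm_num) hs hρs t hst) (h' t hst).le
      linarith
  have hle : s ≤ s + 8 / m := le_add_of_nonneg_right (by positivity)
  have h1 := hmono (mem_Ici.2 le_rfl) (mem_Ici.2 hle) hle
  have h2 := h' _ hle
  simp only [Pi.sub_apply, id] at h1
  have h3 : m / 8 * (8 / m) = 1 := by field_simp
  linarith

namespace IsBddRiccati

variable {q p e x y b₁ b₂ : ℝ → ℝ}

theorem continuous (hx : IsBddRiccati q x) : Continuous x :=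
  continuous_iff_continuousAt.2 fun t => (hx.1 t).continuousAt

theorem hasDerivAt_sub (hx : IsBddRiccati q x) (hy : IsBddRiccati q y) (t : ℝ) :
    HasDerivAt (fun t => y t - x t) (-(x t + y t) * (y t - x t)) t :=
  ((hy.1 t).sub (hx.1 t)).congr_deriv (by ring)

theorem hasDerivAt_log_sub (hx : IsBddRiccati q x) (hy : IsBddRiccati q y)
    (h : ∀ t, x t < y t) (t : ℝ) :
    HasDerivAt (fun t => Real.log (y t - x t)) (-(x t + y t)) t := by
  have h0 : y t - x t ≠ 0 := (sub_pos.2 (h t)).ne'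
  exact ((hx.hasDerivAt_sub hy t).log h0).congr_deriv (by field_simp)

theorem exists_bound (hx : IsBddRiccati q x) (hy : IsBddRiccati q y) :
    ∃ M, 0 < M ∧ ∀ t, |x t| ≤ M ∧ |y t| ≤ M := by
  obtain ⟨C, hC⟩ := hx.2
  obtain ⟨D, hD⟩ := hy.2
  refine ⟨max (max C D) 1, by positivity, fun t => ⟨(hC t).trans ?_, (hD t).trans ?_⟩⟩ <;> simp

/-- Reversing time and sign maps solutions to solutions of the time-reversed equation. -/
theorem neg_comp_neg (hx : IsBddRiccati q x) :
    IsBddRiccati (fun t => q (-t)) (fun t => -x (-t)) := by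
  refine ⟨fun t => ?_, hx.2.imp fun C hC t => by simpa using hC (-t)⟩
  exact ((hx.1 (-t)).scomp t (hasDerivAt_neg t)).neg.congr_deriv (by simp)

theorem eq_or_lt_or_gt (hx : IsBddRiccati q x) (hy : IsBddRiccati q y) :
    x = y ∨ (∀ t, x t < y t) ∨ ∀ t, y t < x t := by
  obtain ⟨S, hS, -⟩ := exists_primitive (f := fun t => -(x t + y t))
    (hx.continuous.add hy.continuous).neg
  have hd : ∀ t, HasDerivAt (fun t => (y t - x t) * Real.exp (-S t)) 0 t := fun t =>
    ((hx.hasDerivAt_sub hy t).mul (hS t).neg.exp).congr_deriv (by simp only [Pi.neg_apply]; ring)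
  have hc : ∀ t, (y t - x t) * Real.exp (-S t) = (y 0 - x 0) * Real.exp (-S 0) := fun t =>
    is_const_of_deriv_eq_zero (fun t => (hd t).differentiableAt) (fun t => (hd t).deriv) t 0
  rcases lt_trichotomy (x 0) (y 0) with h | h | h
  · refine Or.inr (Or.inl fun t => sub_pos.1 ?_)
    have := hc t ▸ mul_pos (sub_pos.2 h) (Real.exp_pos (-S 0))
    exact pos_of_mul_pos_left this (Real.exp_pos _).le
  · refine Or.inl (funext fun t => ?_)
    have := hc t
    rw [h, sub_self, zero_mul, mul_eq_zero] at this
    exact (sub_eq_zero.1 (this.resolve_right (Real.exp_pos _).ne')).symm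
  · refine Or.inr (Or.inr fun t => sub_neg.1 ?_)
    by_contra! hn
    have h1 := mul_nonneg hn (Real.exp_pos (-S t)).le
    rw [hc t] at h1
    nlinarith [Real.exp_pos (-S 0)]

/-- A solution uniformly above another bounded solution is attractive. -/
theorem attrDich_of_separated (hx : IsBddRiccati q x) (hy : IsBddRiccati q y) {m : ℝ}
    (hm : 0 < m) (h : ∀ t, m ≤ y t - x t) : ∃ k β, AttrDich (fun _ => 0) y k β := by
  obtain ⟨M, hM, hb⟩ := hx.exists_bound hy
  have hlt : ∀ t, x t < y t := fun t => by linarith [h t]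
  have hle : ∀ t, y t - x t ≤ 2 * M := fun t => by
    linarith [neg_abs_le (x t), le_abs_self (y t), (hb t).1, (hb t).2]
  obtain ⟨A, hA, hI⟩ := exists_primitive (f := fun t => -2 * y t + 0)
    (by have := hy.continuous; fun_prop)
  have hmono : Monotone fun t => Real.log (y t - x t) - A t - m * t := by
    refine monotone_of_hasDerivAt_nonneg (fun t => ((hx.hasDerivAt_log_sub hy hlt t).sub
      (hA t)).sub ((hasDerivAt_id t).const_mul m)) fun t => ?_
    simp only [Pi.zero_apply]
    linarith [h t]
  refine ⟨2 * M / m, m, (one_le_div hm).2 ((h 0).trans (hle 0)), hm, fun s t hst => ?_⟩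
  rw [hI, ← Real.exp_log (show 0 < 2 * M / m by positivity), ← Real.exp_add, Real.exp_le_exp,
    Real.log_div (by positivity) hm.ne']
  have h1 := hmono hst
  have h2 := Real.log_le_log (sub_pos.2 (hlt t)) (hle t)
  have h3 := Real.log_le_log hm (h s)
  simp only at h1
  linarith

/-- A solution uniformly below another bounded solution is repulsive. -/
theorem repDich_of_separated (hx : IsBddRiccati q x) (hy : IsBddRiccati q y) {m : ℝ}
    (hm : 0 < m) (h : ∀ t, m ≤ y t - x t) : ∃ k β, RepDich (fun _ => 0) x k β := by
  obtain ⟨M, hM, hb⟩ := hx.exists_bound hy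
  have hlt : ∀ t, x t < y t := fun t => by linarith [h t]
  have hle : ∀ t, y t - x t ≤ 2 * M := fun t => by
    linarith [neg_abs_le (x t), le_abs_self (y t), (hb t).1, (hb t).2]
  obtain ⟨A, hA, hI⟩ := exists_primitive (f := fun t => -2 * x t + 0)
    (by have := hx.continuous; fun_prop)
  have hmono : Monotone fun t => A t - Real.log (y t - x t) - m * t := by
    refine monotone_of_hasDerivAt_nonneg (fun t => ((hA t).sub
      (hx.hasDerivAt_log_sub hy hlt t)).sub ((hasDerivAt_id t).const_mul m)) fun t => ?_
    simp only [Pi.zero_apply]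
    linarith [h t]
  refine ⟨2 * M / m, m, (one_le_div hm).2 ((h 0).trans (hle 0)), hm, fun s t hst => ?_⟩
  rw [hI, ← Real.exp_log (show 0 < 2 * M / m by positivity), ← Real.exp_add, Real.exp_le_exp,
    Real.log_div (by positivity) hm.ne']
  have h1 := hmono hst
  have h2 := Real.log_le_log (sub_pos.2 (hlt t)) (hle t)
  have h3 := Real.log_le_log hm (h s)
  simp only at h1
  linarith

theorem exists_primitive_of_attrDich (hy : IsBddRiccati q y) {k β : ℝ}
    (h : AttrDich (fun _ => 0) y k β) :
    ∃ A : ℝ → ℝ, (∀ t, HasDerivAt A (-2 * y t) t) ∧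
      ∀ s t, s ≤ t → A t - A s ≤ Real.log k - β * (t - s) := by
  obtain ⟨A, hA, hI⟩ := exists_primitive (f := fun t => -2 * y t + 0)
    (by have := hy.continuous; fun_prop)
  refine ⟨A, fun t => (hA t).congr_deriv (add_zero _), fun s t hst => ?_⟩
  have h1 := h.2.2 s t hst
  rw [hI, ← Real.exp_log (lt_of_lt_of_le one_pos h.1), ← Real.exp_add, Real.exp_le_exp] at h1
  linarith

theorem exists_primitive_of_repDich (hx : IsBddRiccati q x) {k β : ℝ}
    (h : RepDich (fun _ => 0) x k β) :
    ∃ A : ℝ → ℝ, (∀ t, HasDerivAt A (-2 * x t) t) ∧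
      ∀ s t, s ≤ t → β * (t - s) - Real.log k ≤ A t - A s := by
  obtain ⟨A, hA, hI⟩ := exists_primitive (f := fun t => -2 * x t + 0)
    (by have := hx.continuous; fun_prop)
  refine ⟨A, fun t => (hA t).congr_deriv (add_zero _), fun s t hst => ?_⟩
  have h1 := h.2.2 t s hst
  rw [hI, ← Real.exp_log (lt_of_lt_of_le one_pos h.1), ← Real.exp_add, Real.exp_le_exp] at h1
  linarith

/-- If `A' = -2x` and `B' = -2y`, then `A + B - 2 log (y - x)` is constant. -/
theorem primitive_add_sub_log_const (hx : IsBddRiccati q x) (hy : IsBddRiccati q y)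
    (hlt : ∀ t, x t < y t) {A B : ℝ → ℝ} (hA : ∀ t, HasDerivAt A (-2 * x t) t)
    (hB : ∀ t, HasDerivAt B (-2 * y t) t) (s t : ℝ) :
    A t + B t - 2 * Real.log (y t - x t) = A s + B s - 2 * Real.log (y s - x s) := by
  have hd : ∀ t, HasDerivAt (fun t => A t + B t - 2 * Real.log (y t - x t)) 0 t := fun t =>
    (((hA t).add (hB t)).sub ((hx.hasDerivAt_log_sub hy hlt t).const_mul 2)).congr_deriv (by ring)
  exact is_const_of_deriv_eq_zero (fun t => (hd t).differentiableAt) (fun t => (hd t).deriv) t s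

/-- Of two ordered hyperbolic solutions the upper one is attractive, the lower one repulsive. -/
theorem attrDich_and_repDich (hx : IsBddRiccati q x) (hy : IsBddRiccati q y)
    (hlt : ∀ t, x t < y t)
    (hxh : (∃ k β, AttrDich (fun _ => 0) x k β) ∨ ∃ k β, RepDich (fun _ => 0) x k β)
    (hyh : (∃ k β, AttrDich (fun _ => 0) y k β) ∨ ∃ k β, RepDich (fun _ => 0) y k β) :
    (∃ k β, AttrDich (fun _ => 0) y k β) ∧ ∃ k β, RepDich (fun _ => 0) x k β := by
  obtain ⟨M, hM, hb⟩ := hx.exists_bound hy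
  have hle : ∀ t, Real.log (y t - x t) ≤ Real.log (2 * M) := fun t =>
    Real.log_le_log (sub_pos.2 (hlt t)) (by
      linarith [neg_abs_le (x t), le_abs_self (y t), (hb t).1, (hb t).2])
  rcases hxh with ⟨k, β, hx'⟩ | hx'
  · exfalso
    obtain ⟨A, hA, hA'⟩ := hx.exists_primitive_of_attrDich hx'
    have hβ := hx'.2.1
    rcases hyh with ⟨k', β', hy'⟩ | ⟨k', β', hy'⟩
    · obtain ⟨B, hB, hB'⟩ := hy.exists_primitive_of_attrDich hy'
      have hβ' := hy'.2.1
      obtain ⟨T, hT0, hT⟩ : ∃ T, 0 ≤ T ∧ Real.log k + Real.log k' + 2 * Real.log (2 * M)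
          - 2 * Real.log (y 0 - x 0) < (β + β') * T := by
        obtain ⟨T, hT⟩ := exists_gt (max 0 ((Real.log k + Real.log k' + 2 * Real.log (2 * M)
          - 2 * Real.log (y 0 - x 0)) / (β + β')))
        refine ⟨T, ((le_max_left _ _).trans_lt hT).le, ?_⟩
        have := (le_max_right _ _).trans_lt hT
        rwa [div_lt_iff₀' (by positivity)] at this
      have h1 := hA' (-T) 0 (by linarith)
      have h2 := hB' (-T) 0 (by linarith)
      have h3 := hx.primitive_add_sub_log_const hy hlt hA hB (-T) 0
      have h4 := hle (-T)
      linarith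
    · obtain ⟨B, hB, hB'⟩ := hy.exists_primitive_of_repDich hy'
      have hβ' := hy'.2.1
      obtain ⟨T, hT0, hT⟩ : ∃ T, 0 ≤ T ∧ Real.log k + Real.log k' < (β + β') * T := by
        obtain ⟨T, hT⟩ := exists_gt (max 0 ((Real.log k + Real.log k') / (β + β')))
        refine ⟨T, ((le_max_left _ _).trans_lt hT).le, ?_⟩
        have := (le_max_right _ _).trans_lt hT
        rwa [div_lt_iff₀' (by positivity)] at this
      have hmono : Monotone fun t => A t - B t :=
        monotone_of_hasDerivAt_nonneg (fun t => (hA t).sub (hB t)) fun t => by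
          simp only [Pi.zero_apply]
          linarith [hlt t]
      have h1 := hA' 0 T hT0
      have h2 := hB' 0 T hT0
      have h3 := hmono hT0
      simp only at h3
      linarith
  · refine ⟨hyh.resolve_right ?_, hx'⟩
    rintro ⟨k', β', hy'⟩
    obtain ⟨k, β, hx'⟩ := hx'
    have hβ := hx'.2.1
    have hβ' := hy'.2.1
    obtain ⟨A, hA, hA'⟩ := hx.exists_primitive_of_repDich hx'
    obtain ⟨B, hB, hB'⟩ := hy.exists_primitive_of_repDich hy'
    obtain ⟨T, hT0, hT⟩ : ∃ T, 0 ≤ T ∧ Real.log k + Real.log k' + 2 * Real.log (2 * M)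
        - 2 * Real.log (y 0 - x 0) < (β + β') * T := by
      obtain ⟨T, hT⟩ := exists_gt (max 0 ((Real.log k + Real.log k' + 2 * Real.log (2 * M)
        - 2 * Real.log (y 0 - x 0)) / (β + β')))
      refine ⟨T, ((le_max_left _ _).trans_lt hT).le, ?_⟩
      have := (le_max_right _ _).trans_lt hT
      rwa [div_lt_iff₀' (by positivity)] at this
    have h1 := hA' 0 T hT0
    have h2 := hB' 0 T hT0
    have h3 := hx.primitive_add_sub_log_const hy hlt hA hB 0 T
    have h4 := hle T
    linarith

/-- An attractive solution above a repulsive one is uniformly separated from it. -/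
theorem exists_separation (hx : IsBddRiccati q x) (hy : IsBddRiccati q y)
    (hlt : ∀ t, x t < y t) (hyA : ∃ k β, AttrDich (fun _ => 0) y k β)
    (hxR : ∃ k β, RepDich (fun _ => 0) x k β) : ∃ m, 0 < m ∧ ∀ t, m ≤ y t - x t := by
  obtain ⟨M, hM, hb⟩ := hx.exists_bound hy
  obtain ⟨k, β, hy'⟩ := hyA
  obtain ⟨k', β', hx'⟩ := hxR
  have hβ := hx'.2.1
  have hβ' := hy'.2.1
  obtain ⟨A, hA, hA'⟩ := hx.exists_primitive_of_repDich hx'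
  obtain ⟨B, hB, hB'⟩ := hy.exists_primitive_of_attrDich hy'
  obtain ⟨L, hL0, hL⟩ : ∃ L, 0 < L ∧ 2 * (Real.log k + Real.log k') < (β + β') * L := by
    obtain ⟨L, hL⟩ := exists_gt (max 0 (2 * (Real.log k + Real.log k') / (β + β')))
    refine ⟨L, (le_max_left _ _).trans_lt hL, ?_⟩
    have := (le_max_right _ _).trans_lt hL
    rwa [div_lt_iff₀' (by positivity)] at this
  have hd : ∀ t, HasDerivAt (fun t => A t - B t) (2 * (y t - x t)) t := fun t =>
    ((hA t).sub (hB t)).congr_deriv (by ring)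
  have hanti : Antitone fun t => Real.log (y t - x t) - 2 * M * t :=
    antitone_of_hasDerivAt_nonpos (fun t => (hx.hasDerivAt_log_sub hy hlt t).sub
      ((hasDerivAt_id t).const_mul (2 * M))) fun t => by
        simp only [Pi.zero_apply]
        linarith [neg_abs_le (x t), neg_abs_le (y t), (hb t).1, (hb t).2]
  refine ⟨Real.exp (Real.log ((β + β') / 4) - 2 * M * L), Real.exp_pos _, fun s => ?_⟩
  obtain ⟨r, hr, hr'⟩ := exists_hasDerivAt_eq_slope (fun t => A t - B t)
    (fun t => 2 * (y t - x t)) (show s < s + L by linarith)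
    (fun t _ => (hd t).continuousAt.continuousWithinAt) fun t _ => hd t
  rw [add_sub_cancel_left, eq_div_iff hL0.ne'] at hr'
  have h1 := hA' s (s + L) (by linarith)
  have h2 := hB' s (s + L) (by linarith)
  rw [add_sub_cancel_left] at h1 h2
  have h3 : (β + β') / 4 ≤ y r - x r := by
    by_contra! hn
    nlinarith
  have h4 := hanti hr.1.le
  have h5 := Real.log_le_log (by positivity) h3
  simp only at h4
  rw [← Real.exp_log (sub_pos.2 (hlt s)), Real.exp_le_exp]
  nlinarith [hr.2]

/-- Below a solution `x` lying under another solution `y` there is a bounded solution `l` such that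
`y - l` is not integrable at `+∞`. -/
theorem exists_minimal (hx : IsBddRiccati q x) (hy : IsBddRiccati q y)
    (hlt : ∀ t, x t < y t) :
    ∃ l, IsBddRiccati q l ∧ (∀ t, l t ≤ x t) ∧
      ∃ G : ℝ → ℝ, (∀ t, HasDerivAt G (-(y t - l t)) t) ∧ ∀ K, ∃ t, G t < K := by
  obtain ⟨M, hM, hb⟩ := hx.exists_bound hy
  obtain ⟨S, hS, -⟩ := exists_primitive (f := fun t => -(y t - x t))
    (hy.continuous.sub hx.continuous).neg
  set κ : ℝ → ℝ := fun t => Real.exp (S t) with hκ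
  have hκ0 : ∀ t, 0 < κ t := fun t => Real.exp_pos _
  have hκd : ∀ t, HasDerivAt κ (κ t * -(y t - x t)) t := fun t => (hS t).exp
  have hanti : StrictAnti κ := strictAnti_of_hasDerivAt_neg hκd fun t => by
    nlinarith [hκ0 t, hlt t]
  have hbdd : BddBelow (range κ) := ⟨0, by rintro _ ⟨t, rfl⟩; exact (hκ0 t).le⟩
  set h : ℝ := ⨅ t, κ t with hh
  have hh0 : 0 ≤ h := le_ciInf fun t => (hκ0 t).le
  have hF0 : ∀ t, 0 < κ t - h := fun t =>
    sub_pos.2 ((ciInf_le hbdd (t + 1)).trans_lt (hanti (lt_add_one t)))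
  have hw0 : ∀ t, 0 < y t - x t := fun t => sub_pos.2 (hlt t)
  have hFd : ∀ t, HasDerivAt (fun t => κ t - h) (κ t * -(y t - x t)) t := fun t =>
    (hκd t).sub_const h
  have hyl : ∀ t, y t - (x t - h * (y t - x t) / (κ t - h)) = (y t - x t) * κ t / (κ t - h) :=
    fun t => by
      have := (hF0 t).ne'
      field_simp
      ring
  have hN : ∀ t, (y t - x t) * κ t ≤ 2 * M * (κ t - h) := by
    have hNd : ∀ t, HasDerivAt (fun t => (y t - x t) * κ t - 2 * M * (κ t - h))
        (2 * ((y t - x t) * κ t) * (M - y t)) t := fun t =>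
      (((hx.hasDerivAt_sub hy t).mul (hκd t)).sub ((hFd t).const_mul (2 * M))).congr_deriv
        (by ring)
    have hmono : Monotone fun t => (y t - x t) * κ t - 2 * M * (κ t - h) :=
      monotone_of_hasDerivAt_nonneg hNd fun t => by
        have h1 := mul_pos (hw0 t) (hκ0 t)
        have h2 : 0 ≤ M - y t := by linarith [le_abs_self (y t), (hb t).2]
        simp only [Pi.zero_apply]
        positivity
    by_contra! hn
    obtain ⟨s, hs⟩ := hn
    set a := (y s - x s) * κ s - 2 * M * (κ s - h) with ha
    have ha0 : 0 < a := by linarith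
    have hmono' := monotoneOn_Ici_of_hasDerivAt (T := s)
      (fun t => (hFd t).neg.sub ((hasDerivAt_id t).const_mul a)) fun t hst => by
        have h1 := hmono hst
        have h2 := hF0 t
        simp only at h1
        nlinarith
    have h1 := hmono' (mem_Ici.2 le_rfl) (mem_Ici.2 (show s ≤ s + (κ s - h) / a from
      le_add_of_nonneg_right (div_pos (hF0 s) ha0).le)) (le_add_of_nonneg_right
        (div_pos (hF0 s) ha0).le)
    have h2 := hF0 (s + (κ s - h) / a)
    simp only [Pi.sub_apply, Pi.neg_apply, id] at h1
    rw [mul_add, mul_div_cancel₀ _ ha0.ne'] at h1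
    linarith
  have hy0 : ∀ t, 0 ≤ h * (y t - x t) / (κ t - h) := fun t =>
    div_nonneg (mul_nonneg hh0 (hw0 t).le) (hF0 t).le
  refine ⟨fun t => x t - h * (y t - x t) / (κ t - h), ⟨fun t => ?_, 3 * M, fun t => ?_⟩,
    fun t => sub_le_self _ (hy0 t), fun t => Real.log (κ t - h), fun t => ?_, fun K => ?_⟩
  · refine ((hx.1 t).sub (((hx.hasDerivAt_sub hy t).const_mul h).div (hFd t)
      (hF0 t).ne')).congr_deriv ?_
    have := (hF0 t).ne'
    field_simp
    ring
  · have h1 : h * (y t - x t) / (κ t - h) ≤ 2 * M := by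
      rw [div_le_iff₀ (hF0 t)]
      nlinarith [hN t, hF0 t, hw0 t]
    have h2 := abs_le.1 (hb t).1
    rw [abs_le]
    constructor <;> linarith [hy0 t]
  · refine ((hFd t).log (hF0 t).ne').congr_deriv ?_
    rw [hyl]
    ring
  · obtain ⟨t, ht⟩ := exists_lt_of_ciInf_lt (show ⨅ t, κ t < h + Real.exp K from
      lt_add_of_pos_right _ (Real.exp_pos K))
    exact ⟨t, (Real.log_lt_iff_lt_exp (hF0 t)).2 (by linarith)⟩

/-- The position of a perturbed solution relative to two unperturbed ones obeys a perturbed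
logistic equation. -/
theorem hasDerivAt_ratio (hb₁ : IsBddRiccati p b₁) (hb₂ : IsBddRiccati p b₂)
    (hlt : ∀ t, b₁ t < b₂ t) (hx : IsBddRiccati (fun t => p t - e t) x) (t : ℝ) :
    HasDerivAt (fun t => (x t - b₁ t) / (b₂ t - b₁ t))
      ((b₂ t - b₁ t) * ((x t - b₁ t) / (b₂ t - b₁ t)) * (1 - (x t - b₁ t) / (b₂ t - b₁ t))
        - e t / (b₂ t - b₁ t)) t := by
  have h0 := (sub_pos.2 (hlt t)).ne'
  refine (((hx.1 t).sub (hb₁.1 t)).div (hb₁.hasDerivAt_sub hb₂ t) h0).congr_deriv ?_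
  simp only [Pi.sub_apply]
  field_simp
  ring

theorem exists_separated_atTop (hb₁ : IsBddRiccati p b₁) (hb₂ : IsBddRiccati p b₂) {m : ℝ}
    (hm : 0 < m) (hsep : ∀ t, m ≤ b₂ t - b₁ t) (he : Tendsto e atTop (nhds 0))
    (hx : IsBddRiccati (fun t => p t - e t) x) (hy : IsBddRiccati (fun t => p t - e t) y)
    (hlt : ∀ t, x t < y t) :
    ∃ l, IsBddRiccati (fun t => p t - e t) l ∧ (∀ t, l t ≤ x t) ∧
      ∃ T μ, 0 < μ ∧ ∀ t, T ≤ t → μ ≤ y t - l t := by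
  obtain ⟨l, hl, hlx, G, hG, hGK⟩ := hx.exists_minimal hy hlt
  refine ⟨l, hl, hlx, ?_⟩
  have hly : ∀ t, 0 < y t - l t := fun t => sub_pos.2 ((hlx t).trans_lt (hlt t))
  have hd0 : ∀ t, 0 < b₂ t - b₁ t := fun t => hm.trans_le (hsep t)
  have hb : ∀ t, b₁ t < b₂ t := fun t => sub_pos.1 (hd0 t)
  obtain ⟨T, hT⟩ : ∃ T, ∀ t, T ≤ t → |e t / (b₂ t - b₁ t)| ≤ m / 16 := by
    obtain ⟨T, hT⟩ := Metric.tendsto_atTop.1 he (m / 16 * m) (by positivity)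
    refine ⟨T, fun t ht => ?_⟩
    have h1 := hT t ht
    rw [Real.dist_eq, sub_zero] at h1
    rw [abs_div, abs_of_pos (hd0 t), div_le_iff₀ (hd0 t)]
    nlinarith [hsep t]
  have hρl := hb₁.hasDerivAt_ratio hb₂ hb hl
  have hρy := hb₁.hasDerivAt_ratio hb₂ hb hy
  have hcl := logistic_eventually hm hsep hT hρl
  have hcy := logistic_eventually hm hsep hT hρy
  set ρl : ℝ → ℝ := fun t => (l t - b₁ t) / (b₂ t - b₁ t) with hρl'
  set ρy : ℝ → ℝ := fun t => (y t - b₁ t) / (b₂ t - b₁ t) with hρy'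
  have hzw : ∀ t, (b₂ t - b₁ t) * (ρy t - ρl t) = y t - l t := fun t => by
    have := (hd0 t).ne'
    simp only [ρl, ρy]
    field_simp
    ring
  have hz0 : ∀ t, 0 < ρy t - ρl t := fun t =>
    pos_of_mul_pos_right (by rw [hzw]; exact hly t) (hd0 t).le
  have hz : ∀ t, HasDerivAt (fun t => ρy t - ρl t) ((y t - l t) * (1 - ρl t - ρy t)) t :=
    fun t => ((hρy t).sub (hρl t)).congr_deriv (by rw [← hzw]; ring)
  rcases hcl with hcl | ⟨T₁, hT₁, hcl⟩
  · rcases hcy with hcy | ⟨T₂, hT₂, hcy⟩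
    · exfalso
      obtain ⟨M, hM, hM'⟩ := hl.exists_bound hy
      have hlog : ∀ t, HasDerivAt (fun t => Real.log (ρy t - ρl t) - m / 2 * t)
          ((b₂ t - b₁ t) * (1 - ρl t - ρy t) - m / 2) t := fun t => by
        refine (((hz t).log (hz0 t).ne').sub
          ((hasDerivAt_id t).const_mul (m / 2))).congr_deriv ?_
        have := (hz0 t).ne'
        rw [← hzw]
        field_simp
      have hmono := monotoneOn_Ici_of_hasDerivAt (T := T) hlog fun t ht => by
        nlinarith [hsep t, hcl t ht, hcy t ht]
      obtain ⟨t, ht⟩ := exists_gt (max T (T + (Real.log (2 * M / m)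
        - Real.log (ρy T - ρl T)) / (m / 2)))
      have ht1 : T ≤ t := ((le_max_left _ _).trans_lt ht).le
      have ht3 : (Real.log (2 * M / m) - Real.log (ρy T - ρl T)) / (m / 2) < t - T := by
        linarith [(le_max_right _ _).trans_lt ht]
      rw [div_lt_iff₀ (by positivity)] at ht3
      have h1 := hmono (mem_Ici.2 le_rfl) (mem_Ici.2 ht1) ht1
      have h2 : Real.log (ρy t - ρl t) ≤ Real.log (2 * M / m) := by
        refine Real.log_le_log (hz0 t) ((le_div_iff₀ hm).2 ?_)
        have h3 := hzw t
        have h4 := abs_le.1 (hM' t).1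
        have h5 := abs_le.1 (hM' t).2
        nlinarith [hsep t, hz0 t]
      simp only at h1
      linarith
    · refine ⟨T₂, m / 2, by positivity, fun t ht => ?_⟩
      rw [← hzw]
      nlinarith [hsep t, hcl t (hT₂.trans ht), hcy t ht]
  · rcases hcy with hcy | ⟨T₂, hT₂, hcy⟩
    · exfalso
      linarith [hcl T₁ le_rfl, hcy T₁ hT₁, hz0 T₁]
    · exfalso
      have hmono := monotoneOn_Ici_of_hasDerivAt (T := max T₁ T₂)
        (fun t => (hG t).sub ((hz t).const_mul 2)) fun t ht => by
          have h1 := hcl t ((le_max_left _ _).trans ht)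
          have h2 := hcy t ((le_max_right _ _).trans ht)
          nlinarith [hly t]
      have hanti : Antitone G := antitone_of_hasDerivAt_nonpos hG fun t => by
        simp only [Pi.zero_apply]
        linarith [hly t]
      obtain ⟨t, ht⟩ := hGK (G (max T₁ T₂) - 2 * (ρy (max T₁ T₂) - ρl (max T₁ T₂)))
      rcases le_total t (max T₁ T₂) with h | h
      · linarith [hanti h, hz0 (max T₁ T₂)]
      · have h1 := hmono (mem_Ici.2 le_rfl) (mem_Ici.2 h) h
        simp only [Pi.sub_apply] at h1
        linarith [hz0 t]

/-- Two bounded solutions of a decaying perturbation of an equation with two uniformly separated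
bounded solutions give rise to two uniformly separated bounded solutions. -/
theorem exists_separated (hb₁ : IsBddRiccati p b₁) (hb₂ : IsBddRiccati p b₂) {m : ℝ}
    (hm : 0 < m) (hsep : ∀ t, m ≤ b₂ t - b₁ t) (he : Tendsto e atTop (nhds 0))
    (he' : Tendsto e atBot (nhds 0))
    (hx : IsBddRiccati (fun t => p t - e t) x) (hy : IsBddRiccati (fun t => p t - e t) y)
    (hlt : ∀ t, x t < y t) :
    ∃ l u, IsBddRiccati (fun t => p t - e t) l ∧ IsBddRiccati (fun t => p t - e t) u ∧
      ∃ μ, 0 < μ ∧ ∀ t, μ ≤ u t - l t := by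
  obtain ⟨l, hl, hlx, T, μ, hμ, hT⟩ := exists_separated_atTop hb₁ hb₂ hm hsep he hx hy hlt
  have hly : ∀ t, l t < y t := fun t => (hlx t).trans_lt (hlt t)
  obtain ⟨v, hv, hvy, T', μ', hμ', hT'⟩ := exists_separated_atTop (e := fun t => e (-t))
    hb₂.neg_comp_neg hb₁.neg_comp_neg hm (fun t => by linarith [hsep (-t)])
    (he'.comp tendsto_neg_atTop_atBot) hy.neg_comp_neg hl.neg_comp_neg
    fun t => neg_lt_neg (hly (-t))
  have hu : IsBddRiccati (fun t => p t - e t) fun t => -v (-t) := by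
    simpa using hv.neg_comp_neg
  have hyu : ∀ t, y t ≤ -v (-t) := fun t => by
    have := hvy (-t)
    rw [neg_neg] at this
    linarith
  refine ⟨l, fun t => -v (-t), hl, hu, ?_⟩
  obtain ⟨s, -, hs⟩ := (isCompact_uIcc (a := -T') (b := T)).exists_isMinOn nonempty_uIcc
    (hy.continuous.sub hl.continuous).continuousOn
  refine ⟨min (min μ μ') (y s - l s), lt_min (lt_min hμ hμ') (sub_pos.2 (hly s)), fun t => ?_⟩
  rcases le_total T t with h | h
  · exact ((min_le_left _ _).trans (min_le_left _ _)).trans (by linarith [hT t h, hyu t])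
  rcases le_total t (-T') with h' | h'
  · refine ((min_le_left _ _).trans (min_le_right _ _)).trans ?_
    have := hT' (-t) (by linarith)
    rw [neg_neg] at this
    linarith
  · refine (min_le_right _ _).trans ?_
    have : y s - l s ≤ y t - l t := hs (mem_uIcc.2 (Or.inl ⟨h', h⟩))
    linarith [hyu t]

end IsBddRiccati

theorem isBddSol_zero_iff {p b : ℝ → ℝ} :
    IsBddSol (fun _ => 0) p b ↔ IsBddRiccati p b := by
  refine and_congr_left fun _ => forall_congr' fun t => ?_
  rw [quadF, show -b t ^ 2 + 0 * b t + p t = p t - b t ^ 2 by ring]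

/-- The derivative of `(2/π) arctan (c t)`. -/
noncomputable def arcDeriv (c : ℝ) : ℝ → ℝ := fun t => 2 / Real.pi * (c / (1 + (c * t) ^ 2))

theorem hasDerivAt_arc (c t : ℝ) :
    HasDerivAt (fun t => 2 / Real.pi * Real.arctan (c * t)) (arcDeriv c t) t :=
  ((((hasDerivAt_id t).const_mul c).arctan).const_mul (2 / Real.pi)).congr_deriv (by
    simp only [arcDeriv, id]; ring)

theorem tendsto_arcDeriv {c : ℝ} (hc : 0 < c) {F : Filter ℝ}
    (hF : Tendsto (fun t : ℝ => t ^ 2) F atTop) : Tendsto (arcDeriv c) F (nhds 0) := by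
  have h1 : Tendsto (fun t : ℝ => 1 + (c * t) ^ 2) F atTop := by
    simp only [mul_pow]
    exact tendsto_atTop_add_const_left _ _ (hF.const_mul_atTop (by positivity))
  have h2 := (h1.const_div_atTop c).const_mul (2 / Real.pi)
  rwa [mul_zero] at h2

theorem abs_arc_le (c t : ℝ) : |2 / Real.pi * Real.arctan (c * t)| ≤ 1 := by
  have hpi := Real.pi_pos
  rw [abs_mul, abs_of_pos (by positivity), div_mul_eq_mul_div, div_le_one hpi]
  have : |Real.arctan (c * t)| ≤ Real.pi / 2 :=
    abs_le.2 ⟨(Real.neg_pi_div_two_lt_arctan _).le, (Real.arctan_lt_pi_div_two _).le⟩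
  linarith

theorem isBddRiccati_sub_arc {p y : ℝ → ℝ} {c : ℝ} (hy : IsBddSol (Qarc c) (Parc p c) y) :
    IsBddRiccati (fun t => p t - arcDeriv c t)
      (fun t => y t - 2 / Real.pi * Real.arctan (c * t)) := by
  obtain ⟨hd, C, hC⟩ := hy
  refine ⟨fun t => ((hd t).sub (hasDerivAt_arc c t)).congr_deriv ?_, C + 1, fun t =>
    (abs_sub _ _).trans (add_le_add (hC t) (abs_arc_le c t))⟩
  simp only [quadF, Qarc, Parc]
  ring

theorem isBddSol_add_arc {p x : ℝ → ℝ} {c : ℝ}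
    (hx : IsBddRiccati (fun t => p t - arcDeriv c t) x) :
    IsBddSol (Qarc c) (Parc p c) (fun t => x t + 2 / Real.pi * Real.arctan (c * t)) := by
  obtain ⟨hd, C, hC⟩ := hx
  refine ⟨fun t => ((hd t).add (hasDerivAt_arc c t)).congr_deriv ?_, C + 1, fun t =>
    (abs_add_le _ _).trans (add_le_add (hC t) (abs_arc_le c t))⟩
  simp only [quadF, Qarc, Parc]
  ring

theorem variational_add_arc (x : ℝ → ℝ) (c s t : ℝ) :
    ∫ l in s..t, (-2 * (x l + 2 / Real.pi * Real.arctan (c * l)) + Qarc c l) =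
      ∫ l in s..t, (-2 * x l + 0) := by
  congr 1
  ext l
  simp only [Qarc]
  ring

/-- If the unperturbed equation has two different hyperbolic solutions, then two different bounded
solutions of the transition equation yield two different hyperbolic ones. -/
theorem exists_two_hyp_of_two_bddSol {p b₁ b₂ y₁ y₂ : ℝ → ℝ} {c : ℝ} (hc : 0 < c)
    (hb : b₁ ≠ b₂) (hb₁ : IsHyp (fun _ => 0) p b₁) (hb₂ : IsHyp (fun _ => 0) p b₂)
    (hy : y₁ ≠ y₂) (hy₁ : IsBddSol (Qarc c) (Parc p c) y₁)
    (hy₂ : IsBddSol (Qarc c) (Parc p c) y₂) :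
    ∃ u l : ℝ → ℝ, u ≠ l ∧ IsHyp (Qarc c) (Parc p c) u ∧ IsHyp (Qarc c) (Parc p c) l := by
  rw [IsHyp, IsAttrHyp, IsRepHyp, isBddSol_zero_iff, ← and_or_left] at hb₁ hb₂
  obtain ⟨b, b', hbs, hbs', m, hm, hsep⟩ : ∃ b b', IsBddRiccati p b ∧ IsBddRiccati p b' ∧
      ∃ m, 0 < m ∧ ∀ t, m ≤ b' t - b t := by
    rcases hb₁.1.eq_or_lt_or_gt hb₂.1 with h | h | h
    · exact (hb h).elim
    · obtain ⟨hA, hR⟩ := hb₁.1.attrDich_and_repDich hb₂.1 h hb₁.2 hb₂.2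
      exact ⟨b₁, b₂, hb₁.1, hb₂.1, hb₁.1.exists_separation hb₂.1 h hA hR⟩
    · obtain ⟨hA, hR⟩ := hb₂.1.attrDich_and_repDich hb₁.1 h hb₂.2 hb₁.2
      exact ⟨b₂, b₁, hb₂.1, hb₁.1, hb₂.1.exists_separation hb₁.1 h hA hR⟩
  have hx₁ := isBddRiccati_sub_arc hy₁
  have hx₂ := isBddRiccati_sub_arc hy₂
  have hTop := tendsto_arcDeriv hc (tendsto_pow_atTop two_ne_zero)
  have hBot := tendsto_arcDeriv hc (by
    simpa only [Function.comp_def, sq_abs] using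
      (tendsto_pow_atTop (α := ℝ) two_ne_zero).comp tendsto_abs_atBot_atTop)
  obtain ⟨l, u, hl, hu, μ, hμ, hlu⟩ : ∃ l u, IsBddRiccati (fun t => p t - arcDeriv c t) l ∧
      IsBddRiccati (fun t => p t - arcDeriv c t) u ∧ ∃ μ, 0 < μ ∧ ∀ t, μ ≤ u t - l t := by
    rcases hx₁.eq_or_lt_or_gt hx₂ with h | h | h
    · exact (hy (funext fun t => sub_left_injective (congrFun h t))).elim
    · exact hbs.exists_separated hbs' hm hsep hTop hBot hx₁ hx₂ h
    · exact hbs.exists_separated hbs' hm hsep hTop hBot hx₂ hx₁ h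
  obtain ⟨k, β, hA⟩ := hl.attrDich_of_separated hu hμ hlu
  obtain ⟨k', β', hR⟩ := hl.repDich_of_separated hu hμ hlu
  refine ⟨_, _, fun h => ?_, Or.inl ⟨isBddSol_add_arc hu, k, β, ?_⟩,
    Or.inr ⟨isBddSol_add_arc hl, k', β', ?_⟩⟩
  · have := congrFun h 0
    simp only [add_left_inj] at this
    linarith [hlu 0]
  · simpa only [AttrDich, variational_add_arc] using hA
  · simpa only [RepDich, variational_add_arc] using hR

theorem stmt16 (p : ℝ → ℝ)
    (hpb : ∃ C, ∀ t, |p t| ≤ C) (hpu : UniformContinuous p)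
    -- Hypothesis: x' = −x² + p(t) has exactly two hyperbolic solutions
    (hhyp : ∃ b₁ b₂ : ℝ → ℝ, b₁ ≠ b₂ ∧ IsHyp (fun _ => 0) p b₁ ∧ IsHyp (fun _ => 0) p b₂ ∧
      ∀ b : ℝ → ℝ, IsHyp (fun _ => 0) p b → b = b₁ ∨ b = b₂) :
    ∀ c : ℝ, 0 < c →
      -- exactly one of Case A, Case B, Case C holds
      ((∃ b₁ b₂ : ℝ → ℝ, b₁ ≠ b₂ ∧ IsHyp (Qarc c) (Parc p c) b₁ ∧ IsHyp (Qarc c) (Parc p c) b₂) ∨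
        (∃! b : ℝ → ℝ, IsBddSol (Qarc c) (Parc p c) b) ∨
        (¬ ∃ b : ℝ → ℝ, IsBddSol (Qarc c) (Parc p c) b)) ∧
      ¬ ((∃ b₁ b₂ : ℝ → ℝ, b₁ ≠ b₂ ∧ IsHyp (Qarc c) (Parc p c) b₁ ∧ IsHyp (Qarc c) (Parc p c) b₂) ∧
        (∃! b : ℝ → ℝ, IsBddSol (Qarc c) (Parc p c) b)) ∧
      ¬ ((∃ b₁ b₂ : ℝ → ℝ, b₁ ≠ b₂ ∧ IsHyp (Qarc c) (Parc p c) b₁ ∧ IsHyp (Qarc c) (Parc p c) b₂) ∧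
        (¬ ∃ b : ℝ → ℝ, IsBddSol (Qarc c) (Parc p c) b)) ∧
      ¬ ((∃! b : ℝ → ℝ, IsBddSol (Qarc c) (Parc p c) b) ∧
        (¬ ∃ b : ℝ → ℝ, IsBddSol (Qarc c) (Parc p c) b)) := by
  intro c hc
  obtain ⟨a₁, a₂, ha, ha₁, ha₂, -⟩ := hhyp
  have hbdd : ∀ {b}, IsHyp (Qarc c) (Parc p c) b → IsBddSol (Qarc c) (Parc p c) b :=
    fun h => h.elim And.left And.left
  refine ⟨?_, ?_, ?_, ?_⟩
  · by_cases hex : ∃ b, IsBddSol (Qarc c) (Parc p c) b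
    · by_cases huniq : ∃! b, IsBddSol (Qarc c) (Parc p c) b
      · exact Or.inr (Or.inl huniq)
      · obtain ⟨y₁, hy₁⟩ := hex
        obtain ⟨y₂, hy₂, hne⟩ : ∃ y₂, IsBddSol (Qarc c) (Parc p c) y₂ ∧ y₁ ≠ y₂ := by
          by_contra! hn
          exact huniq ⟨y₁, hy₁, fun y hy => (hn y hy).symm⟩
        exact Or.inl (exists_two_hyp_of_two_bddSol hc ha ha₁ ha₂ hne hy₁ hy₂)
    · exact Or.inr (Or.inr hex)
  · rintro ⟨⟨b₁, b₂, hne, h₁, h₂⟩, hu⟩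
    exact hne (hu.unique (hbdd h₁) (hbdd h₂))
  · rintro ⟨⟨b₁, _, _, h₁, _⟩, hn⟩
    exact hn ⟨b₁, hbdd h₁⟩
  · rintro ⟨hu, hn⟩
    exact hn hu.exists
end

section
/- Assume the equation x' = −x² + p(t) has exactly two hyperbolic solutions, and define λ_* : [0,∞) → ℝ by λ_*(c) := λ*(0, p − q_c) (with q_0 ≡ 0). Then: (i) λ_* is Lipschitz continuous with |λ_*(c₂) − λ_*(c₁)| ≤ (2/π)|c₂ − c₁| for all c₁, c₂ ≥ 0, and λ_*(c) ∈ [λ_*(0), ‖p‖ + 1] for all c ≥ 0; (ii) if the equation x' = −x² + p(t) + λ_*(0) has exactly one globally defined bounded solution, then λ_*(c) > λ_*(0) for every c > 0. -/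
open Set Filter

/-- `q_c(t) = 2c/(π(c²t²+1))` (note that `q_0 ≡ 0`). -/
noncomputable def qc (c : ℝ) : ℝ → ℝ := fun t => 2 * c / (Real.pi * (c ^ 2 * t ^ 2 + 1))

open MeasureTheory Topology

/-- The bounded solution `∫_{-∞}^t e^{-L(t-s)} f(s) ds` of `x' = f(t) - L x`. -/
noncomputable def expAvg (L : ℝ) (f : ℝ → ℝ) (t : ℝ) : ℝ :=
  Real.exp (-L * t) * ∫ s in Iic t, Real.exp (L * s) * f s

section expAvg

variable {L C : ℝ} {f g : ℝ → ℝ}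

lemma integrableOn_exp_mul_bdd (hL : 0 < L) (hf : Measurable f) (hC : ∀ t, |f t| ≤ C) (t : ℝ) :
    IntegrableOn (fun s => Real.exp (L * s) * f s) (Iic t) :=
  (integrableOn_exp_mul_Iic hL t).mul_bdd hf.aestronglyMeasurable (ae_of_all _ hC)

lemma expAvg_const (hL : 0 < L) (c t : ℝ) : expAvg L (fun _ => c) t = c / L := by
  have h : Real.exp (-L * t) * Real.exp (L * t) = 1 := by
    rw [← Real.exp_add]; simp
  rw [expAvg, integral_mul_const, integral_exp_mul_Iic hL]
  calc _ = (Real.exp (-L * t) * Real.exp (L * t)) * c / L := by ring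
    _ = c / L := by rw [h, one_mul]

lemma expAvg_mono {D : ℝ} (hL : 0 < L) (hf : Measurable f) (hC : ∀ t, |f t| ≤ C)
    (hg : Measurable g) (hD : ∀ t, |g t| ≤ D) (hfg : ∀ t, f t ≤ g t) (t : ℝ) :
    expAvg L f t ≤ expAvg L g t := by
  refine mul_le_mul_of_nonneg_left ?_ (Real.exp_pos _).le
  exact integral_mono (integrableOn_exp_mul_bdd hL hf hC t) (integrableOn_exp_mul_bdd hL hg hD t)
    fun s => mul_le_mul_of_nonneg_left (hfg s) (Real.exp_pos _).le

lemma expAvg_eq_intervalIntegral (hL : 0 < L) (hf : Measurable f) (hC : ∀ t, |f t| ≤ C) :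
    expAvg L f = fun t => Real.exp (-L * t) * ((∫ s in Iic 0, Real.exp (L * s) * f s)
      + ∫ s in (0 : ℝ)..t, Real.exp (L * s) * f s) := by
  funext t
  rw [expAvg, ← intervalIntegral.integral_Iic_sub_Iic (integrableOn_exp_mul_bdd hL hf hC 0)
    (integrableOn_exp_mul_bdd hL hf hC t)]
  ring

lemma continuous_expAvg (hL : 0 < L) (hf : Measurable f) (hC : ∀ t, |f t| ≤ C) :
    Continuous (expAvg L f) := by
  rw [expAvg_eq_intervalIntegral hL hf hC]
  have h : Continuous fun t => ∫ s in (0 : ℝ)..t, Real.exp (L * s) * f s := by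
    refine intervalIntegral.continuous_primitive (fun a b => ?_) 0
    exact ((integrableOn_exp_mul_bdd hL hf hC (max a b)).mono_set
      (fun x hx => hx.2)).intervalIntegrable
  fun_prop

lemma hasDerivAt_expAvg (hL : 0 < L) (hf : Continuous f) (hC : ∀ t, |f t| ≤ C) (t : ℝ) :
    HasDerivAt (expAvg L f) (f t - L * expAvg L f t) t := by
  have hc : Continuous fun s => Real.exp (L * s) * f s := by fun_prop
  have h1 : HasDerivAt (fun t => ∫ s in (0 : ℝ)..t, Real.exp (L * s) * f s)
      (Real.exp (L * t) * f t) t := hc.integral_hasStrictDerivAt 0 t |>.hasDerivAt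
  have h2 : HasDerivAt (fun t => Real.exp (-L * t)) (Real.exp (-L * t) * (-L)) t := by
    simpa using ((hasDerivAt_id t).const_mul (-L)).exp
  have h : Real.exp (-L * t) * Real.exp (L * t) = 1 := by
    rw [← Real.exp_add]; simp
  rw [expAvg_eq_intervalIntegral hL hf.measurable hC]
  refine (h2.mul (h1.const_add _)).congr_deriv ?_
  linear_combination f t * h

lemma expAvg_eq_of_hasDerivAt {B : ℝ} {b : ℝ → ℝ} (hL : 0 < L) (hf : Measurable f)
    (hC : ∀ t, |f t| ≤ C) (hB : ∀ t, |b t| ≤ B) (hb : ∀ t, HasDerivAt b (f t - L * b t) t) :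
    expAvg L f = b := by
  funext t
  have hd : ∀ s ∈ Iic t, HasDerivAt (fun s => Real.exp (L * s) * b s) (Real.exp (L * s) * f s) s := by
    intro s _
    have h2 : HasDerivAt (fun t => Real.exp (L * t)) (Real.exp (L * s) * L) s := by
      simpa using ((hasDerivAt_id s).const_mul L).exp
    exact (h2.mul (hb s)).congr_deriv (by ring)
  have hlim : Tendsto (fun s => Real.exp (L * s) * b s) atBot (𝓝 0) := by
    have he : Tendsto (fun s => Real.exp (L * s)) atBot (𝓝 0) :=
      Real.tendsto_exp_atBot.comp (tendsto_id.const_mul_atBot hL)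
    exact he.zero_mul_isBoundedUnder_le (isBoundedUnder_of ⟨B, hB⟩)
  have h : Real.exp (-L * t) * Real.exp (L * t) = 1 := by
    rw [← Real.exp_add]; simp
  rw [expAvg, integral_Iic_of_hasDerivAt_of_tendsto' hd (integrableOn_exp_mul_bdd hL hf hC t) hlim]
  linear_combination b t * h

lemma tendsto_expAvg {F : ℕ → ℝ → ℝ} (hL : 0 < L) (hF : ∀ n, Measurable (F n))
    (hC : ∀ n t, |F n t| ≤ C) (hlim : ∀ t, Tendsto (fun n => F n t) atTop (𝓝 (f t))) (t : ℝ) :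
    Tendsto (fun n => expAvg L (F n) t) atTop (𝓝 (expAvg L f t)) := by
  refine Tendsto.const_mul _ ?_
  refine tendsto_integral_of_dominated_convergence (fun s => Real.exp (L * s) * C)
    (fun n => (integrableOn_exp_mul_bdd hL (hF n) (hC n) t).aestronglyMeasurable)
    ((integrableOn_exp_mul_Iic hL t).mul_const C) (fun n => ae_of_all _ fun s => ?_)
    (ae_of_all _ fun s => (hlim s).const_mul _)
  rw [norm_mul, Real.norm_eq_abs, Real.norm_eq_abs, Real.abs_exp]
  exact mul_le_mul_of_nonneg_left (hC n s) (Real.exp_pos _).le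

end expAvg

lemma quad_abs_le {K M x y : ℝ} (hK : 0 ≤ K) (hx : |x| ≤ K) (hy : |y| ≤ M) :
    |2 * K * x - x ^ 2 + y| ≤ 3 * K ^ 2 + M := by
  rw [abs_le] at *
  constructor <;> nlinarith

lemma quad_le_quad {K x y p q : ℝ} (hxy : x ≤ y) (hy : y ≤ K) (hpq : p ≤ q) :
    2 * K * x - x ^ 2 + p ≤ 2 * K * y - y ^ 2 + q := by
  nlinarith [mul_nonneg (sub_nonneg.2 hxy) (by linarith : 0 ≤ 2 * K - x - y)]

/-- A bounded solution for a smaller forcing term lies below a bounded solution, obtained as the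
limit of a monotone iteration of an integral operator. -/
theorem exists_isBddSol_ge {P P' b : ℝ → ℝ} (hP : Continuous P) (hPb : ∃ M, ∀ t, |P t| ≤ M)
    (hP' : Continuous P') (hPb' : ∃ M, ∀ t, |P' t| ≤ M) (hle : ∀ t, P' t ≤ P t)
    (hb : IsBddSol (fun _ => 0) P' b) :
    ∃ a, IsBddSol (fun _ => 0) P a ∧ ∀ t, b t ≤ a t := by
  obtain ⟨M, hM⟩ := hPb
  obtain ⟨M', hM'⟩ := hPb'
  obtain ⟨hbd, B, hB⟩ := hb
  have hM0 : 0 ≤ M := (abs_nonneg _).trans (hM 0)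
  have hB0 : 0 ≤ B := (abs_nonneg _).trans (hB 0)
  obtain ⟨K, hKB, hK1, hKM⟩ : ∃ K, B ≤ K ∧ 1 ≤ K ∧ M ≤ K ^ 2 :=
    ⟨B + M + 1, by linarith, by linarith, by nlinarith⟩
  have hK0 : 0 ≤ K := by linarith
  have hL : 0 < 2 * K := by linarith
  have hbc : Continuous b := continuous_iff_continuousAt.2 fun t => (hbd t).continuousAt
  have hbK : ∀ t, |b t| ≤ K := fun t => (hB t).trans hKB
  let G : (ℝ → ℝ) → ℝ → ℝ := fun u t => 2 * K * u t - u t ^ 2 + P t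
  have hGc : ∀ u, Continuous u → Continuous (G u) := fun u hu => by
    show Continuous fun t => 2 * K * u t - u t ^ 2 + P t
    fun_prop
  have hGb : ∀ u : ℝ → ℝ, (∀ t, |u t| ≤ K) → ∀ t, |G u t| ≤ 3 * K ^ 2 + M :=
    fun u hu t => quad_abs_le hK0 (hu t) (hM t)
  have habs : ∀ u : ℝ → ℝ, (∀ t, b t ≤ u t) → (∀ t, u t ≤ K) → ∀ t, |u t| ≤ K :=
    fun u h1 h2 t => abs_le.2 ⟨(abs_le.1 (hbK t)).1.trans (h1 t), h2 t⟩
  have hGmono : ∀ u v : ℝ → ℝ, Continuous u → Continuous v → (∀ t, |u t| ≤ K) →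
      (∀ t, |v t| ≤ K) → (∀ t, u t ≤ v t) → ∀ t, expAvg (2 * K) (G u) t ≤ expAvg (2 * K) (G v) t :=
    fun u v hu hv hu' hv' huv => expAvg_mono hL (hGc u hu).measurable (hGb u hu')
      (hGc v hv).measurable (hGb v hv')
      fun t => quad_le_quad (huv t) (abs_le.1 (hv' t)).2 le_rfl
  have hGK : ∀ u : ℝ → ℝ, Continuous u → (∀ t, |u t| ≤ K) → ∀ t, expAvg (2 * K) (G u) t ≤ K := by
    intro u hu hu' t
    have h := expAvg_mono (g := fun _ => 2 * K * K) hL (hGc u hu).measurable (hGb u hu')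
      measurable_const (fun _ => le_rfl) (fun t => ?_) t
    · rw [expAvg_const hL] at h
      rwa [mul_div_assoc, mul_div_cancel₀ _ hL.ne'] at h
    · have := quad_le_quad (p := P t) (abs_le.1 (hu' t)).2 le_rfl (abs_le.1 (hM t)).2
      show 2 * K * u t - u t ^ 2 + P t ≤ 2 * K * K
      linarith
  have hGb0 : ∀ t, b t ≤ expAvg (2 * K) (G b) t := by
    intro t
    have hc : Continuous fun t => 2 * K * b t - b t ^ 2 + P' t := by fun_prop
    have hbd' : ∀ t, |2 * K * b t - b t ^ 2 + P' t| ≤ 3 * K ^ 2 + M' :=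
      fun t => quad_abs_le hK0 (hbK t) (hM' t)
    have h := expAvg_eq_of_hasDerivAt hL hc.measurable hbd' hB fun t =>
      (hbd t).congr_deriv (by simp only [quadF]; ring)
    have h2 := expAvg_mono hL hc.measurable hbd' (hGc b hbc).measurable (hGb b hbK)
      (fun t => quad_le_quad le_rfl (abs_le.1 (hbK t)).2 (hle t)) t
    rwa [h] at h2
  let u : ℕ → ℝ → ℝ := fun n => Nat.rec b (fun _ v => expAvg (2 * K) (G v)) n
  have hsucc : ∀ n, u (n + 1) = expAvg (2 * K) (G (u n)) := fun n => rfl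
  have hu : ∀ n, Continuous (u n) ∧ (∀ t, b t ≤ u n t) ∧ (∀ t, u n t ≤ K) ∧
      ∀ t, u n t ≤ u (n + 1) t := by
    intro n
    induction n with
    | zero => exact ⟨hbc, fun t => le_rfl, fun t => (abs_le.1 (hbK t)).2, hGb0⟩
    | succ n ih =>
      obtain ⟨h1, h2, h3, h4⟩ := ih
      have hK := habs _ h2 h3
      have c1 : Continuous (u (n + 1)) := continuous_expAvg hL (hGc _ h1).measurable (hGb _ hK)
      have c2 : ∀ t, b t ≤ u (n + 1) t := fun t => (h2 t).trans (h4 t)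
      have c3 : ∀ t, u (n + 1) t ≤ K := hGK _ h1 hK
      exact ⟨c1, c2, c3, hGmono _ _ h1 c1 hK (habs _ c2 c3) h4⟩
  have huK : ∀ n t, |u n t| ≤ K := fun n => habs _ (hu n).2.1 (hu n).2.2.1
  have hmono : ∀ t, Monotone fun n => u n t :=
    fun t => monotone_nat_of_le_succ fun n => (hu n).2.2.2 t
  let a : ℝ → ℝ := fun t => ⨆ n, u n t
  have hlim : ∀ t, Tendsto (fun n => u n t) atTop (𝓝 (a t)) := fun t =>
    tendsto_atTop_ciSup (hmono t) ⟨K, by rintro _ ⟨n, rfl⟩; exact (hu n).2.2.1 t⟩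
  have hba : ∀ t, b t ≤ a t := fun t => ge_of_tendsto' (hlim t) fun n => (hu n).2.1 t
  have haK : ∀ t, |a t| ≤ K :=
    habs a hba fun t => le_of_tendsto' (hlim t) fun n => (hu n).2.2.1 t
  have ham : Measurable a := measurable_of_tendsto_metrizable (fun n => (hu n).1.measurable)
    (tendsto_pi_nhds.2 hlim)
  have hGam : Measurable (G a) :=
    ((ham.const_mul (2 * K)).sub (ham.pow_const 2)).add hP.measurable
  have hfix : a = expAvg (2 * K) (G a) := by
    funext t
    refine tendsto_nhds_unique ((tendsto_add_atTop_iff_nat 1).2 (hlim t)) ?_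
    exact tendsto_expAvg hL (fun n => (hGc _ (hu n).1).measurable) (fun n => hGb _ (huK n))
      (fun t => (((hlim t).const_mul (2 * K)).sub ((hlim t).pow 2)).add_const (P t)) t
  have hac : Continuous a := by
    rw [hfix]
    exact continuous_expAvg hL hGam (hGb a haK)
  refine ⟨a, ⟨fun t => ?_, K, haK⟩, hba⟩
  have h := hasDerivAt_expAvg hL (hGc a hac) (hGb a haK) t
  rw [← hfix] at h
  refine h.congr_deriv ?_
  simp only [quadF, G]
  ring

lemma IsBddSol.reverse {P b : ℝ → ℝ} (hb : IsBddSol (fun _ => 0) P b) :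
    IsBddSol (fun _ => 0) (fun t => P (-t)) fun t => -b (-t) := by
  obtain ⟨hbd, B, hB⟩ := hb
  refine ⟨fun t => ?_, B, fun t => by simpa using hB (-t)⟩
  refine (((hbd (-t)).comp t (hasDerivAt_neg t)).neg).congr_deriv ?_
  simp only [quadF]
  ring

theorem exists_isBddSol_le {P P' b : ℝ → ℝ} (hP : Continuous P) (hPb : ∃ M, ∀ t, |P t| ≤ M)
    (hP' : Continuous P') (hPb' : ∃ M, ∀ t, |P' t| ≤ M) (hle : ∀ t, P' t ≤ P t)
    (hb : IsBddSol (fun _ => 0) P' b) :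
    ∃ a, IsBddSol (fun _ => 0) P a ∧ ∀ t, a t ≤ b t := by
  obtain ⟨M, hM⟩ := hPb
  obtain ⟨M', hM'⟩ := hPb'
  obtain ⟨a, ha, hba⟩ := exists_isBddSol_ge (P := fun t => P (-t)) (hP.comp continuous_neg)
    ⟨M, fun t => hM (-t)⟩ (hP'.comp continuous_neg) ⟨M', fun t => hM' (-t)⟩
    (fun t => hle (-t)) hb.reverse
  refine ⟨fun t => -a (-t), by simpa using ha.reverse, fun t => ?_⟩
  have := hba (-t)
  rw [neg_neg] at this
  linarith

lemma qc_zero (t : ℝ) : qc 0 t = 0 := by simp [qc]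

lemma qc_nonneg {c : ℝ} (hc : 0 ≤ c) (t : ℝ) : 0 ≤ qc c t := by
  have := Real.pi_pos
  unfold qc
  positivity

lemma qc_pos {c : ℝ} (hc : 0 < c) (t : ℝ) : 0 < qc c t := by
  have := Real.pi_pos
  unfold qc
  positivity

lemma continuous_qc (c : ℝ) : Continuous (qc c) := by
  have h : ∀ t : ℝ, Real.pi * (c ^ 2 * t ^ 2 + 1) ≠ 0 := fun t => by
    have := Real.pi_pos
    positivity
  unfold qc
  fun_prop (disch := exact h _)

lemma qc_sub_le (c₁ c₂ t : ℝ) :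
    |qc c₁ t - qc c₂ t| ≤ 2 / Real.pi * |c₁ - c₂| := by
  have hpi := Real.pi_pos
  have h1 : 0 < c₁ ^ 2 * t ^ 2 + 1 := by positivity
  have h2 : 0 < c₂ ^ 2 * t ^ 2 + 1 := by positivity
  have h12 := mul_pos h1 h2
  have key : qc c₁ t - qc c₂ t = 2 / Real.pi * ((c₁ - c₂) *
      ((1 - c₁ * c₂ * t ^ 2) / ((c₁ ^ 2 * t ^ 2 + 1) * (c₂ ^ 2 * t ^ 2 + 1)))) := by
    unfold qc
    field_simp
    ring
  rw [key, abs_mul, abs_of_pos (by positivity : 0 < 2 / Real.pi), abs_mul]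
  refine mul_le_mul_of_nonneg_left ?_ (by positivity)
  refine mul_le_of_le_one_right (abs_nonneg _) ?_
  rw [abs_div, abs_of_pos h12, div_le_one h12, abs_le]
  constructor
  · nlinarith [mul_nonneg (sq_nonneg (c₁ - c₂)) (sq_nonneg t),
      mul_nonneg (sq_nonneg (c₁ + c₂)) (sq_nonneg t), sq_nonneg (c₁ * c₂ * t ^ 2)]
  · nlinarith [mul_nonneg (sq_nonneg (c₁ - c₂)) (sq_nonneg t),
      mul_nonneg (sq_nonneg (c₁ + c₂)) (sq_nonneg t), sq_nonneg (c₁ * c₂ * t ^ 2)]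

lemma qc_bdd (c : ℝ) (t : ℝ) : |qc c t| ≤ 2 / Real.pi * |c| := by
  simpa [qc_zero] using qc_sub_le c 0 t

lemma two_div_pi_mul_arctan_sq_le (x : ℝ) : (2 / Real.pi * Real.arctan x) ^ 2 ≤ 1 := by
  have hpi := Real.pi_pos
  have h : |2 / Real.pi * Real.arctan x| ≤ 1 := by
    rw [abs_mul, abs_of_pos (by positivity : 0 < 2 / Real.pi), div_mul_eq_mul_div,
      div_le_one hpi]
    have := abs_le.2 ⟨(Real.neg_pi_div_two_lt_arctan x).le, (Real.arctan_lt_pi_div_two x).le⟩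
    linarith
  exact (sq_le_one_iff_abs_le_one _).2 h

/-- The function `-(2/π) arctan (c t)` has derivative `-q_c`. -/
lemma isBddSol_arctan (c : ℝ) : IsBddSol (fun _ => 0)
    (fun t => (2 / Real.pi * Real.arctan (c * t)) ^ 2 - qc c t)
    fun t => -(2 / Real.pi * Real.arctan (c * t)) := by
  have hpi := Real.pi_pos
  refine ⟨fun t => ?_, 1, fun t => ?_⟩
  · have h : HasDerivAt (fun t => c * t) c t := by simpa using (hasDerivAt_id t).const_mul c
    refine ((h.arctan.const_mul (2 / Real.pi)).neg).congr_deriv ?_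
    have h2 : 0 < c ^ 2 * t ^ 2 + 1 := by positivity
    have h3 : 1 + (c * t) ^ 2 = c ^ 2 * t ^ 2 + 1 := by ring
    simp only [quadF, qc]
    rw [h3]
    field_simp
    ring
  · rw [abs_neg]
    exact (sq_le_one_iff_abs_le_one _).1 (two_div_pi_mul_arctan_sq_le _)

theorem stmt19 (p : ℝ → ℝ)
    (hpb : ∃ C, ∀ t, |p t| ≤ C) (hpu : UniformContinuous p)
    -- Hypothesis: x' = −x² + p(t) has exactly two hyperbolic solutions
    (hhyp : ∃ b₁ b₂ : ℝ → ℝ, b₁ ≠ b₂ ∧ IsHyp (fun _ => 0) p b₁ ∧ IsHyp (fun _ => 0) p b₂ ∧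
      ∀ b : ℝ → ℝ, IsHyp (fun _ => 0) p b → b = b₁ ∨ b = b₂)
    -- λ_*(c) := λ*(0, p − q_c) for c ≥ 0
    (lam : ℝ → ℝ)
    (hlam : ∀ c : ℝ, 0 ≤ c → ∀ mu : ℝ,
      (∃ b : ℝ → ℝ, IsBddSol (fun _ => 0) (fun t => p t - qc c t + mu) b) ↔ lam c ≤ mu) :
    -- (i) Lipschitz continuity and range
    (∀ c₁ c₂ : ℝ, 0 ≤ c₁ → 0 ≤ c₂ → |lam c₂ - lam c₁| ≤ 2 / Real.pi * |c₂ - c₁|) ∧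
    (∀ c : ℝ, 0 ≤ c → lam 0 ≤ lam c ∧ lam c ≤ (⨆ t : ℝ, |p t|) + 1) ∧
    -- (ii)
    ((∃! b : ℝ → ℝ, IsBddSol (fun _ => 0) (fun t => p t + lam 0) b) →
      ∀ c : ℝ, 0 < c → lam 0 < lam c) := by
  have hpi := Real.pi_pos
  have hpc := hpu.continuous
  obtain ⟨C, hC⟩ := hpb
  have hcont : ∀ c mu : ℝ, Continuous fun t => p t - qc c t + mu := fun c mu =>
    (hpc.sub (continuous_qc c)).add_const mu
  have hbdd : ∀ c mu : ℝ, ∃ M, ∀ t, |p t - qc c t + mu| ≤ M := fun c mu =>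
    ⟨C + 2 / Real.pi * |c| + |mu|, fun t => (abs_add_le _ _).trans
      (add_le_add_left ((abs_sub _ _).trans (add_le_add (hC t) (qc_bdd c t))) _)⟩
  have hcomp : ∀ c₁ c₂ d : ℝ, 0 ≤ c₁ → 0 ≤ c₂ → (∀ t, qc c₂ t - qc c₁ t ≤ d) →
      lam c₂ ≤ lam c₁ + d := by
    intro c₁ c₂ d h₁ h₂ hd
    obtain ⟨b, hb⟩ := (hlam c₁ h₁ (lam c₁)).2 le_rfl
    obtain ⟨a, ha, -⟩ := exists_isBddSol_ge (hcont c₂ (lam c₁ + d)) (hbdd _ _) (hcont _ _)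
      (hbdd _ _) (fun t => by linarith [hd t]) hb
    exact (hlam c₂ h₂ _).1 ⟨a, ha⟩
  have hsup : ∀ t, |p t| ≤ ⨆ t, |p t| :=
    fun t => le_ciSup (f := fun t => |p t|) ⟨C, by rintro _ ⟨s, rfl⟩; exact hC s⟩ t
  refine ⟨fun c₁ c₂ h₁ h₂ => ?_, fun c hc => ⟨?_, ?_⟩, ?_⟩
  · have e1 := hcomp c₁ c₂ _ h₁ h₂ fun t => (le_abs_self _).trans (qc_sub_le c₂ c₁ t)
    have e2 := hcomp c₂ c₁ _ h₂ h₁ fun t => (le_abs_self _).trans (qc_sub_le c₁ c₂ t)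
    rw [abs_sub_comm c₁ c₂] at e2
    rw [abs_le]
    constructor <;> linarith
  · have := hcomp c 0 0 hc le_rfl fun t => by linarith [qc_zero t, qc_nonneg hc t]
    linarith
  · obtain ⟨a, ha, -⟩ := exists_isBddSol_ge (hcont c ((⨆ t, |p t|) + 1)) (hbdd _ _)
      (((Real.continuous_arctan.comp (continuous_const_mul c)).const_mul (2 / Real.pi) |>.pow 2).sub
        (continuous_qc c))
      ⟨1 + 2 / Real.pi * |c|, fun t => (abs_sub _ _).trans (add_le_add
        (by rw [abs_of_nonneg (sq_nonneg _)]; exact two_div_pi_mul_arctan_sq_le _) (qc_bdd c t))⟩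
      (fun t => by
        have := two_div_pi_mul_arctan_sq_le (c * t)
        have := (abs_le.1 (hsup t)).1
        show (2 / Real.pi * Real.arctan (c * t)) ^ 2 - qc c t ≤ _
        linarith) (isBddSol_arctan c)
    exact (hlam c hc _).1 ⟨a, ha⟩
  · rintro ⟨x, -, hx⟩ c hc
    by_contra! hle
    obtain ⟨b, hb⟩ := (hlam c hc.le (lam 0)).2 hle
    have hq : ∀ t, p t - qc c t + lam 0 ≤ p t + lam 0 := fun t => by linarith [qc_nonneg hc.le t]
    have hP : Continuous fun t => p t + lam 0 := hpc.add_const _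
    have hPb : ∃ M, ∀ t, |p t + lam 0| ≤ M :=
      ⟨C + |lam 0|, fun t => (abs_add_le _ _).trans (add_le_add_left (hC t) _)⟩
    obtain ⟨a, ha, hba⟩ := exists_isBddSol_ge hP hPb (hcont _ _) (hbdd _ _) hq hb
    obtain ⟨r, hr, hrb⟩ := exists_isBddSol_le hP hPb (hcont _ _) (hbdd _ _) hq hb
    have har : r = a := (hx r hr).trans (hx a ha).symm
    subst har
    have hbr : b = r := funext fun t => le_antisymm (hba t) (hrb t)
    subst hbr
    have h := (hb.1 0).unique (ha.1 0)
    simp only [quadF] at h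
    linarith [qc_pos hc 0]
end
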